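/- arXiv:2605.11451 — 2 statements merged into one kernel-verified Lean document; each statement's English description precedes it below -/
import Mathlib

section
/- Let X be uniformly distributed on the unit ball B_p^n of ℓ_p^n and let r > -1. Then E|X_1|^r = Γ(1+n/p)·Γ((r+1)/p) / (Γ(1/p)·Γ(1+(n+r)/p)). In particular E[X_1^2] = Γ(3/p)·Γ(1+n/p)/(Γ(1/p)·Γ(1+(n+2)/p)). -/
open Real MeasureTheory

theorem aux_integral {p s : ℝ} (hp : 0 < p) (hs : -1 < s) :
    ∫ y : ℝ, |y| ^ s * exp (-|y| ^ p) = 2 / p * Gamma ((s + 1) / p) := by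
  rw [integral_comp_abs (f := fun y => y ^ s * exp (-y ^ p)), integral_rpow_mul_exp_neg_rpow hp hs]
  ring

theorem aux_pos {p s : ℝ} (hp : 0 < p) (hs : -1 < s) : 0 < Gamma ((s + 1) / p) :=
  Gamma_pos_of_pos (div_pos (by linarith) hp)

theorem aux_integrable {p s : ℝ} (hp : 0 < p) (hs : -1 < s) :
    Integrable (fun y : ℝ => |y| ^ s * exp (-|y| ^ p)) := by
  by_contra h
  have h1 := integral_undef h
  rw [aux_integral hp hs] at h1
  have := aux_pos hp hs
  have : 0 < 2 / p * Gamma ((s + 1) / p) := by positivity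
  linarith

theorem aux_prod {n : ℕ} (i0 : Fin n) {p r : ℝ} (hp : 0 < p) (hr : -1 < r) :
    ∫⁻ x : Fin n → ℝ, ENNReal.ofReal (|x i0| ^ r) * ENNReal.ofReal (exp (-∑ i, |x i| ^ p))
      = ENNReal.ofReal ((2 / p) ^ n * Gamma ((r + 1) / p) * Gamma (1 / p) ^ (n - 1)) := by
  let s : Fin n → ℝ := fun i => if i = i0 then r else 0
  have hs : ∀ i, -1 < s i := by
    intro i
    simp only [s]
    split_ifs <;> linarith
  have key : ∀ x : Fin n → ℝ, ENNReal.ofReal (|x i0| ^ r) * ENNReal.ofReal (exp (-∑ i, |x i| ^ p))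
      = ENNReal.ofReal (∏ i, (|x i| ^ s i * exp (-|x i| ^ p))) := by
    intro x
    rw [← ENNReal.ofReal_mul (by positivity), Finset.prod_mul_distrib, ← exp_sum,
      Finset.sum_neg_distrib, Finset.prod_eq_single i0]
    · simp [s]
    · intro b _ hb
      simp [s, hb]
    · simp
  simp_rw [key]
  have hint : Integrable (fun x : Fin n → ℝ => ∏ i, (|x i| ^ s i * exp (-|x i| ^ p))) :=
    Integrable.fintype_prod (f := fun i y => |y| ^ s i * exp (-|y| ^ p))
      (fun i => aux_integrable hp (hs i))
  rw [← ofReal_integral_eq_lintegral_ofReal hint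
    (Filter.Eventually.of_forall fun x => by dsimp; positivity),
    integral_fintype_prod_volume_eq_prod (f := fun i (y : ℝ) => |y| ^ s i * exp (-|y| ^ p))]
  congr 1
  simp_rw [fun i => aux_integral hp (hs i)]
  rw [Finset.prod_mul_distrib, Finset.prod_const, Finset.card_univ, Fintype.card_fin,
    ← Finset.mul_prod_erase _ _ (Finset.mem_univ i0), mul_assoc]
  congr 2
  · simp [s]
  · rw [Finset.prod_congr rfl (g := fun _ => Gamma (1 / p)), Finset.prod_const,
      Finset.card_erase_of_mem (Finset.mem_univ _), Finset.card_univ, Fintype.card_fin]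
    intro i hi
    simp [s, Finset.ne_of_mem_erase hi]

theorem aux_exp {c : ℝ} (hc : 0 ≤ c) :
    ENNReal.ofReal (exp (-c)) =
      ∫⁻ t in Set.Ioi (0 : ℝ), (Set.Ici c).indicator (fun t => ENNReal.ofReal (exp (-t))) t := by
  rw [lintegral_indicator measurableSet_Ici, Measure.restrict_restrict measurableSet_Ici]
  have h : (Set.Ici c ∩ Set.Ioi 0 : Set ℝ) =ᵐ[volume] Set.Ioi c := by
    rcases hc.eq_or_lt with h | h
    · subst h
      rw [Set.inter_eq_right.2 Set.Ioi_subset_Ici_self]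
      exact ae_eq_refl _
    · rw [Set.inter_eq_left.2 (Set.Ici_subset_Ioi.2 h)]
      exact Ioi_ae_eq_Ici.symm
  rw [setLIntegral_congr h, ← ofReal_integral_eq_lintegral_ofReal, integral_exp_neg_Ioi]
  · exact integrableOn_exp_neg_Ioi c
  · exact Filter.Eventually.of_forall fun x => (exp_pos _).le

theorem aux_meas {n : ℕ} {p : ℝ} (hp : 0 < p) :
    Continuous (fun x : Fin n → ℝ => ∑ i, |x i| ^ p) := by
  refine continuous_finsetSum _ fun i _ => ?_
  exact (continuous_abs.comp (continuous_apply i)).rpow_const fun _ => Or.inr hp.le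

theorem aux_scale {n : ℕ} (i0 : Fin n) {p r : ℝ} (hp : 0 < p) {t : ℝ} (ht : 0 < t) :
    ∫⁻ x in {x : Fin n → ℝ | ∑ i, |x i| ^ p ≤ t}, ENNReal.ofReal (|x i0| ^ r)
      = ENNReal.ofReal (t ^ ((n + r) / p)) *
        ∫⁻ x in {x : Fin n → ℝ | ∑ i, |x i| ^ p ≤ 1}, ENNReal.ofReal (|x i0| ^ r) := by
  have hm := (aux_meas (n := n) hp).measurable
  have hF : Measurable (fun x : Fin n → ℝ => ENNReal.ofReal (|x i0| ^ r)) := by fun_prop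
  set R : ℝ := t ^ (1 / p) with hR
  have hR0 : 0 < R := by positivity
  have hRp : R ^ p = t := by
    rw [hR, ← rpow_mul ht.le, one_div_mul_cancel hp.ne', rpow_one]
  have hset : ∀ u : ℝ, MeasurableSet {x : Fin n → ℝ | ∑ i, |x i| ^ p ≤ u} := fun u =>
    measurableSet_le hm measurable_const
  have hmap := Measure.map_addHaar_smul (volume : Measure (Fin n → ℝ)) hR0.ne'
  have h1 : ∫⁻ x, ({x : Fin n → ℝ | ∑ i, |x i| ^ p ≤ t}.indicator
      (fun x => ENNReal.ofReal (|x i0| ^ r))) x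
        ∂(Measure.map (R • ·) (volume : Measure (Fin n → ℝ)))
      = ENNReal.ofReal (R ^ r) *
        ∫⁻ x in {x : Fin n → ℝ | ∑ i, |x i| ^ p ≤ 1}, ENNReal.ofReal (|x i0| ^ r) := by
    rw [lintegral_map (hF.indicator (hset t)) (measurable_const_smul R),
      ← lintegral_const_mul _ hF, ← lintegral_indicator (hset 1)]
    congr 1
    ext x
    have e1 : ∑ i, |(R • x) i| ^ p = t * ∑ i, |x i| ^ p := by
      rw [Finset.mul_sum]
      refine Finset.sum_congr rfl fun i _ => ?_
      rw [Pi.smul_apply, smul_eq_mul, abs_mul, abs_of_pos hR0, mul_rpow hR0.le (abs_nonneg _), hRp]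
    have e2 : (∑ i, |(R • x) i| ^ p ≤ t) ↔ ∑ i, |x i| ^ p ≤ 1 := by
      rw [e1]
      exact mul_le_iff_le_one_right ht
    by_cases hx : ∑ i, |x i| ^ p ≤ 1
    · rw [Set.indicator_of_mem (by exact e2.2 hx), Set.indicator_of_mem (by exact hx),
        Pi.smul_apply, smul_eq_mul, abs_mul, abs_of_pos hR0, mul_rpow hR0.le (abs_nonneg _),
        ENNReal.ofReal_mul (by positivity)]
    · rw [Set.indicator_of_notMem (by exact fun h => hx (e2.1 h)),
        Set.indicator_of_notMem (by exact hx)]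
  rw [hmap, lintegral_smul_measure, lintegral_indicator (hset t), smul_eq_mul,
    Module.finrank_fin_fun, abs_of_pos (by positivity)] at h1
  have h2 : ENNReal.ofReal (R ^ n) * ENNReal.ofReal (R ^ n)⁻¹ = 1 := by
    rw [← ENNReal.ofReal_mul (by positivity), mul_inv_cancel₀ (by positivity), ENNReal.ofReal_one]
  have h3 : t ^ ((n + r) / p) = R ^ n * R ^ r := by
    rw [← rpow_natCast, ← rpow_add hR0, hR, ← rpow_mul ht.le]
    congr 1
    ring
  rw [h3, ENNReal.ofReal_mul (by positivity), mul_assoc, ← h1, ← mul_assoc, h2, one_mul]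

theorem aux_main {n : ℕ} (i0 : Fin n) {p r : ℝ} (hp : 0 < p) (hr : -1 < r) :
    ∫⁻ x in {x : Fin n → ℝ | ∑ i, |x i| ^ p ≤ 1}, ENNReal.ofReal (|x i0| ^ r)
      = ENNReal.ofReal ((2 / p) ^ n * Gamma ((r + 1) / p) * Gamma (1 / p) ^ (n - 1)
          / Gamma (1 + (n + r) / p)) := by
  have hm := (aux_meas (n := n) hp).measurable
  have hF : Measurable (fun x : Fin n → ℝ => ENNReal.ofReal (|x i0| ^ r)) := by fun_prop
  have hset : ∀ u : ℝ, MeasurableSet {x : Fin n → ℝ | ∑ i, |x i| ^ p ≤ u} := fun u =>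
    measurableSet_le hm measurable_const
  have hn : (1 : ℝ) ≤ n := by exact_mod_cast i0.pos
  have hq : 0 < (n + r) / p := div_pos (by linarith) hp
  have hG : 0 < Gamma (1 + (n + r) / p) := Gamma_pos_of_pos (by linarith)
  have hA := aux_prod i0 hp hr
  have hE : ∀ x : Fin n → ℝ, ENNReal.ofReal (|x i0| ^ r) *
      ENNReal.ofReal (exp (-∑ i, |x i| ^ p)) = ∫⁻ t in Set.Ioi (0 : ℝ),
        {z : (Fin n → ℝ) × ℝ | ∑ i, |z.1 i| ^ p ≤ z.2}.indicator
          (fun z => ENNReal.ofReal (|z.1 i0| ^ r) * ENNReal.ofReal (exp (-z.2))) (x, t) := by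
    intro x
    rw [aux_exp (Finset.sum_nonneg fun i _ => by positivity), ← lintegral_const_mul]
    · congr 1
      ext t
      by_cases h : ∑ i, |x i| ^ p ≤ t
      · rw [Set.indicator_of_mem (by exact h), Set.indicator_of_mem (by exact h)]
      · rw [Set.indicator_of_notMem (by exact h), Set.indicator_of_notMem (by exact h), mul_zero]
    · exact Measurable.indicator (by fun_prop) measurableSet_Ici
  simp_rw [hE] at hA
  rw [lintegral_lintegral_swap] at hA
  · have h4 : ∀ t ∈ Set.Ioi (0 : ℝ), ∫⁻ x : Fin n → ℝ,
        {z : (Fin n → ℝ) × ℝ | ∑ i, |z.1 i| ^ p ≤ z.2}.indicator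
          (fun z => ENNReal.ofReal (|z.1 i0| ^ r) * ENNReal.ofReal (exp (-z.2))) (x, t)
        = ENNReal.ofReal (exp (-t) * t ^ ((1 + (n + r) / p) - 1)) *
        ∫⁻ x in {x : Fin n → ℝ | ∑ i, |x i| ^ p ≤ 1}, ENNReal.ofReal (|x i0| ^ r) := by
      intro t ht
      rw [ENNReal.ofReal_mul (exp_pos _).le, mul_assoc, add_sub_cancel_left,
        ← aux_scale i0 hp ht, ← lintegral_const_mul _ hF, ← lintegral_indicator (hset t)]
      congr 1
      ext x
      by_cases h : ∑ i, |x i| ^ p ≤ t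
      · rw [Set.indicator_of_mem (by exact h), Set.indicator_of_mem (by exact h), mul_comm]
      · rw [Set.indicator_of_notMem (by exact h), Set.indicator_of_notMem (by exact h)]
    rw [setLIntegral_congr_fun measurableSet_Ioi h4, lintegral_mul_const _ (by fun_prop),
      ← ofReal_integral_eq_lintegral_ofReal (GammaIntegral_convergent (by linarith)),
      ← Gamma_eq_integral (by linarith)] at hA
    · rw [ENNReal.ofReal_div_of_pos hG, ← hA, mul_comm, ENNReal.mul_div_cancel_right]
      · simpa using hG
      · simp
    · refine (ae_restrict_iff' measurableSet_Ioi).2 (Filter.Eventually.of_forall fun t ht => ?_)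
      have : 0 < t := ht
      dsimp
      positivity
  · refine Measurable.aemeasurable (Measurable.indicator ?_ ?_)
    · fun_prop
    · exact measurableSet_le (hm.comp measurable_fst) measurable_snd

theorem aux_final {n : ℕ} (i0 : Fin n) {p r : ℝ} (hp : 0 < p) (hr : -1 < r)
    (B : Set (Fin n → ℝ)) (hB : B = {x : Fin n → ℝ | ∑ i, |x i| ^ p ≤ 1}) :
    ∫ x, |x i0| ^ r ∂((volume B)⁻¹ • volume.restrict B)
      = Gamma (1 + n / p) * Gamma ((r + 1) / p)
          / (Gamma (1 / p) * Gamma (1 + ((n : ℝ) + r) / p)) := by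
  have hn : (1 : ℝ) ≤ n := by exact_mod_cast i0.pos
  have hG : 0 < Gamma (1 + (n + r) / p) :=
    Gamma_pos_of_pos (by have := div_pos (show 0 < n + r by linarith) hp; linarith)
  have hG0 : 0 < Gamma (1 + n / p) := Gamma_pos_of_pos (by positivity)
  have hG1 : 0 < Gamma (1 / p) := Gamma_pos_of_pos (by positivity)
  have hGr := aux_pos hp hr
  have h0 := aux_main i0 hp (r := 0) (by norm_num)
  have h1 := aux_main i0 hp hr
  rw [← hB] at h0 h1
  simp only [rpow_zero, ENNReal.ofReal_one, setLIntegral_one, zero_add, add_zero] at h0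
  rw [integral_smul_measure, integral_eq_lintegral_of_nonneg_ae, h1, h0, ENNReal.toReal_inv,
    ENNReal.toReal_ofReal (by positivity), ENNReal.toReal_ofReal (by positivity), smul_eq_mul]
  · field_simp
  · exact Filter.Eventually.of_forall fun x => by dsimp; positivity
  · exact Measurable.aestronglyMeasurable (by fun_prop)


theorem stmt_0 (n : ℕ) (hn : 2 ≤ n) (p r : ℝ) (hp : 1 ≤ p) (hr : -1 < r)
    (B : Set (Fin n → ℝ)) (hB : B = {x : Fin n → ℝ | ∑ i, |x i| ^ p ≤ 1})
    (μ : Measure (Fin n → ℝ)) (hμ : μ = (volume B)⁻¹ • volume.restrict B) :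
    (∫ x, |x ⟨0, by omega⟩| ^ r ∂μ)
        = Gamma (1 + n / p) * Gamma ((r + 1) / p)
          / (Gamma (1 / p) * Gamma (1 + ((n : ℝ) + r) / p)) ∧
    (∫ x, (x ⟨0, by omega⟩) ^ 2 ∂μ)
        = Gamma (3 / p) * Gamma (1 + n / p)
          / (Gamma (1 / p) * Gamma (1 + ((n : ℝ) + 2) / p)) := by

  have hp0 : 0 < p := by linarith
  subst hμ
  refine ⟨aux_final _ hp0 hr B hB, ?_⟩
  have h := aux_final ⟨0, by omega⟩ hp0 (r := 2) (by norm_num) B hB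
  simp only [rpow_two, sq_abs] at h
  rw [h]
  norm_num
  ring
end

section
/- Let 1 ≤ p < 2 and let Z have density g_p(x) = e^{−|x|^p}/(2Γ(1+1/p)) on ℝ. Then there exists a non-degenerate positive random variable V such that the density of Z equals E[(2πV)^{-1/2} exp(−x²/(2V))] for every x ∈ ℝ; that is, g_p is a Gaussian scale mixture. -/
open Real MeasureTheory
open Filter Topology Set

lemma aux_nonneg {q w : ℝ} (hw : 0 < w) {r : ℝ} (hr : 0 ≤ r) :
    0 ≤ 1 - exp (-(r * w ^ (-q))) ∧ 1 - exp (-(r * w ^ (-q))) ≤ 1 ∧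
    1 - exp (-(r * w ^ (-q))) ≤ r * w ^ (-q) := by
  have h : 0 ≤ w ^ (-q) := rpow_nonneg hw.le _
  have h2 : 0 ≤ r * w ^ (-q) := mul_nonneg hr h
  refine ⟨?_, ?_, ?_⟩
  · have := exp_le_one_iff.2 (neg_nonpos.2 h2); linarith
  · have := exp_pos (-(r * w ^ (-q))); linarith
  · have := add_one_le_exp (-(r * w ^ (-q))); linarith

lemma aux_integrable_s4 {q : ℝ} (hq : 1 < q) {r : ℝ} (hr : 0 ≤ r) :
    IntegrableOn (fun w : ℝ => 1 - exp (-(r * w ^ (-q)))) (Ioi 0) := by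
  have hm : Measurable (fun w : ℝ => 1 - exp (-(r * w ^ (-q)))) := by fun_prop
  rw [← Ioc_union_Ioi_eq_Ioi (zero_le_one' ℝ)]
  refine IntegrableOn.union ?_ ?_
  · refine Measure.integrableOn_of_bounded (M := 1) (by simp) hm.aestronglyMeasurable ?_
    refine (ae_restrict_iff' measurableSet_Ioc).2 (ae_of_all _ fun w hw => ?_)
    have := aux_nonneg (q := q) hw.1 hr
    rw [norm_eq_abs, abs_of_nonneg this.1]; exact this.2.1
  · have h := (integrableOn_Ioi_rpow_of_lt (a := -q) (by linarith) zero_lt_one).const_mul r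
    refine Integrable.mono' h hm.aestronglyMeasurable ?_
    refine (ae_restrict_iff' measurableSet_Ioi).2 (ae_of_all _ fun w hw => ?_)
    have := aux_nonneg (q := q) (lt_trans zero_lt_one hw) hr
    rw [norm_eq_abs, abs_of_nonneg this.1]; exact this.2.2

lemma aux_scale_s4 {q : ℝ} (hq : 1 < q) {r : ℝ} (hr : 0 < r) :
    ∫ w in Ioi (0:ℝ), (1 - exp (-(r * w ^ (-q)))) =
      r ^ (1 / q) * ∫ w in Ioi (0:ℝ), (1 - exp (-(w ^ (-q)))) := by
  have hb : 0 < r ^ (1 / q) := rpow_pos_of_pos hr _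
  have h := integral_comp_mul_left_Ioi' (fun w : ℝ => 1 - exp (-(r * w ^ (-q)))) 0 hb
  rw [mul_zero] at h
  rw [← h, smul_eq_mul]
  congr 1
  refine setIntegral_congr_fun measurableSet_Ioi fun w hw => ?_
  have hw : 0 < w := hw
  rw [mul_rpow hb.le hw.le, ← rpow_mul hr.le]
  have : 1 / q * -q = -1 := by field_simp
  rw [this, rpow_neg_one, ← mul_assoc, mul_inv_cancel₀ hr.ne', one_mul]

lemma aux_C_pos {q : ℝ} (hq : 1 < q) :
    0 < ∫ w in Ioi (0:ℝ), (1 - exp (-(w ^ (-q)))) := by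
  have hi := aux_integrable_s4 hq zero_le_one
  simp only [one_mul] at hi
  rw [setIntegral_pos_iff_support_of_nonneg_ae _ hi]
  · refine lt_of_lt_of_le (b := volume (Ioi (0:ℝ))) (by simp) (measure_mono fun w hw => ⟨?_, hw⟩)
    have : 0 < w ^ (-q) := rpow_pos_of_pos hw _
    have := exp_lt_one_iff.2 (neg_lt_zero.2 this)
    simp only [Function.mem_support]; linarith
  · refine (ae_restrict_iff' measurableSet_Ioi).2 (ae_of_all _ fun w hw => ?_)
    have := (aux_nonneg (q := q) hw zero_le_one).1
    simpa using this

/-- points of the unit interval -/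
noncomputable def gI (q : ℝ) (w : ℝ) : unitInterval :=
  ⟨exp (-|w ^ (-q)|), (exp_pos _).le, exp_le_one_iff.2 (by simp)⟩

@[fun_prop]
lemma gI_meas (q : ℝ) : Measurable (gI q) := by
  unfold gI
  apply Measurable.subtype_mk
  fun_prop

noncomputable def unif (N : ℕ) : Measure ℝ := ENNReal.ofReal (1 / N) • volume.restrict (Ioc 0 (N:ℝ))

instance unif_prob (N : ℕ) : IsProbabilityMeasure (unif (N + 1)) := by
  constructor
  rw [unif, Measure.smul_apply, Measure.restrict_apply MeasurableSet.univ, univ_inter,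
    Real.volume_Ioc, smul_eq_mul, ← ENNReal.ofReal_mul (by positivity), sub_zero,
    one_div_mul_cancel (by positivity), ENNReal.ofReal_one]

lemma gI_rpow {q w r : ℝ} (hw : 0 < w) : ((gI q w : unitInterval) : ℝ) ^ r = exp (-(r * w ^ (-q))) := by
  simp only [gI]
  rw [abs_of_nonneg (rpow_nonneg hw.le _), ← exp_mul]
  ring_nf

lemma unif_int {q : ℝ} (hq : 1 < q) {r : ℝ} (hr : 0 < r) (N : ℕ) :
    ∫ w, ((gI q w : unitInterval) : ℝ) ^ r ∂(unif (N+1)) =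
      1 + (-(1 / ((N+1 : ℕ):ℝ) * ∫ w in (0:ℝ)..((N+1 : ℕ):ℝ), (1 - exp (-(r * w ^ (-q)))))) := by
  have hN : (0:ℝ) < ((N+1 : ℕ):ℝ) := by positivity
  rw [unif, integral_smul_measure, ENNReal.toReal_ofReal (by positivity), smul_eq_mul]
  rw [setIntegral_congr_fun (g := fun w : ℝ => 1 - (1 - exp (-(r * w ^ (-q))))) measurableSet_Ioc
    (fun w hw => by simp only [gI_rpow hw.1]; ring)]
  rw [intervalIntegral.integral_of_le hN.le, integral_sub]
  · simp only [integral_const, measureReal_restrict_apply_univ, Real.volume_real_Ioc_of_le hN.le, smul_eq_mul]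
    field_simp
    ring
  · exact integrable_const _
  · exact (aux_integrable_s4 hq hr.le).mono_set Ioc_subset_Ioi_self

lemma prod_meas (q : ℝ) (n : ℕ) : Measurable (fun w : Fin n → ℝ => ∏ i, gI q (w i)) :=
  Finset.measurable_fun_prod _ fun i _ => (gI_meas q).comp (measurable_pi_apply i)

noncomputable def MN (q : ℝ) (N : ℕ) : ProbabilityMeasure unitInterval :=
  ⟨(Measure.pi (fun _ : Fin (N+1) => unif (N+1))).map (fun w : Fin (N+1) → ℝ => ∏ i, gI q (w i)), by
    have h := (prod_meas q (N+1)).aemeasurable (μ := Measure.pi (fun _ : Fin (N+1) => unif (N+1)))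
    exact Measure.isProbabilityMeasure_map h⟩

lemma MN_int {q : ℝ} (r : ℝ) (hr : 0 < r) (N : ℕ) :
    ∫ s, (s : ℝ) ^ r ∂(MN q N : Measure unitInterval) =
      (∫ w, ((gI q w : unitInterval) : ℝ) ^ r ∂(unif (N+1))) ^ (N+1) := by
  have hg := gI_meas q
  have h := integral_fintype_prod_eq_pow (ι := Fin (N+1)) (μ := unif (N+1))
    (fun w => ((gI q w : unitInterval) : ℝ) ^ r)
  rw [Fintype.card_fin] at h
  rw [← h]
  simp only [MN, ProbabilityMeasure.coe_mk]
  rw [integral_map (prod_meas q (N+1)).aemeasurable (by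
    refine Measurable.aestronglyMeasurable ?_
    fun_prop)]
  congr 1
  ext w
  have : ((∏ i, gI q (w i) : unitInterval) : ℝ) = ∏ i, ((gI q (w i) : unitInterval) : ℝ) :=
    map_prod (unitInterval.submonoid.subtype) _ _
  rw [this, Real.finsetProd_rpow _ _ (fun i _ => (gI q (w i)).2.1)]

lemma MN_tendsto {q : ℝ} (hq : 1 < q) (r : ℝ) (hr : 0 < r) :
    Tendsto (fun N => ∫ s, (s : ℝ) ^ r ∂(MN q N : Measure unitInterval)) atTop
      (𝓝 (exp (-(r ^ (1 / q) * ∫ w in Ioi (0:ℝ), (1 - exp (-(w ^ (-q)))))))) := by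
  have h1 := intervalIntegral_tendsto_integral_Ioi 0 (aux_integrable_s4 hq hr.le)
    (tendsto_natCast_atTop_atTop (R := ℝ))
  rw [aux_scale_s4 hq hr] at h1
  have h2 := Real.tendsto_one_add_pow_exp_of_tendsto
    (g := fun N : ℕ => (-(1 / (N:ℝ) * ∫ w in (0:ℝ)..(N:ℝ), (1 - exp (-(r * w ^ (-q)))))))
    (h1.neg.congr' (by
      filter_upwards [eventually_gt_atTop 0] with N hN
      have : (0:ℝ) < N := by exact_mod_cast hN
      field_simp))
  refine ((tendsto_add_atTop_iff_nat 1).2 h2).congr fun N => ?_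
  rw [MN_int r hr, unif_int hq hr]

lemma exists_stable {q : ℝ} (hq : 1 < q) : ∃ m : Measure unitInterval, IsProbabilityMeasure m ∧
    ∃ C : ℝ, 0 < C ∧ ∀ r : ℝ, 0 < r → ∫ s, (s : ℝ) ^ r ∂m = exp (-(r ^ (1 / q) * C)) := by
  let U : Ultrafilter (ProbabilityMeasure unitInterval) := (hyperfilter ℕ).map (MN q)
  have hU : Tendsto (MN q) (hyperfilter ℕ) (𝓝 U.lim) := U.le_nhds_lim
  refine ⟨U.lim, inferInstance, _, aux_C_pos hq, fun r hr => ?_⟩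
  rw [ProbabilityMeasure.tendsto_iff_forall_integral_tendsto] at hU
  have hc : Continuous (fun s : unitInterval => (s:ℝ) ^ r) :=
    continuous_subtype_val.rpow_const (fun _ => Or.inr hr.le)
  have := hU (BoundedContinuousFunction.mkOfCompact ⟨_, hc⟩)
  exact tendsto_nhds_unique this ((MN_tendsto hq r hr).mono_left (Nat.hyperfilter_le_atTop))

lemma exists_stable' {q : ℝ} (hq : 1 < q) : ∃ m : Measure unitInterval, IsProbabilityMeasure m ∧
    ∃ T : unitInterval → ℝ, Measurable T ∧ (∀ᵐ s ∂m, 0 < T s) ∧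
    ∀ r : ℝ, 0 ≤ r → ∫ s, exp (-(r * T s)) ∂m = exp (-(r ^ (1 / q))) := by
  obtain ⟨m, hm, C, hC, h⟩ := exists_stable hq
  have hq0 : 0 < 1 / q := by positivity
  have hmeas (r : ℝ) (hr : 0 < r) : Integrable (fun s : unitInterval => (s:ℝ) ^ r) m := by
    refine Integrable.of_bound (C := 1) (by
      refine Measurable.aestronglyMeasurable ?_
      fun_prop) (ae_of_all _ fun s => ?_)
    rw [norm_eq_abs, abs_of_nonneg (rpow_nonneg s.2.1 _)]
    exact rpow_le_one s.2.1 s.2.2 hr.le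
  have h0 : ∀ᵐ s ∂m, s ≠ 0 := by
    have key : ∀ r : ℝ, 0 < r → exp (-(r ^ (1 / q) * C)) ≤ m.real {0}ᶜ := by
      intro r hr
      rw [← h r hr, ← integral_indicator_one (by measurability)]
      refine integral_mono (hmeas r hr) ((integrable_const _).indicator (by measurability)) fun s => ?_
      by_cases hs : s = 0
      · simp [hs, hr.ne']
      · simpa [hs] using rpow_le_one s.2.1 s.2.2 hr.le
    have hl : Tendsto (fun r : ℝ => exp (-(r ^ (1 / q) * C))) (𝓝[>] 0) (𝓝 1) := by
      have : ContinuousAt (fun r : ℝ => exp (-(r ^ (1 / q) * C))) 0 := by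
        have := continuousAt_rpow_const 0 (1/q) (Or.inr hq0.le)
        fun_prop
      have h := this.tendsto.mono_left (nhdsWithin_le_nhds (s := Ioi 0))
      simpa [hq0.ne', zero_rpow (inv_ne_zero (by positivity : q ≠ 0))] using h
    have h1 : 1 ≤ m.real {0}ᶜ := le_of_tendsto hl (by
      filter_upwards [self_mem_nhdsWithin] with r hr using key r hr)
    rw [probReal_compl_eq_one_sub (by measurability)] at h1
    have h2 : m.real {0} = 0 := le_antisymm (by linarith) measureReal_nonneg
    rw [measureReal_eq_zero_iff] at h2
    simpa [ae_iff] using h2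
  have h1 : ∀ᵐ s ∂m, s ≠ 1 := by
    have key : ∀ r : ℝ, 0 < r → m.real {1} ≤ exp (-(r ^ (1 / q) * C)) := by
      intro r hr
      rw [← h r hr, ← integral_indicator_one (by measurability)]
      refine integral_mono ((integrable_const _).indicator (by measurability)) (hmeas r hr) fun s => ?_
      by_cases hs : s = 1
      · simp [hs]
      · simpa [hs] using rpow_nonneg s.2.1 _
    have hl : Tendsto (fun r : ℝ => exp (-(r ^ (1 / q) * C))) atTop (𝓝 0) :=
      tendsto_exp_neg_atTop_nhds_zero.comp ((tendsto_rpow_atTop hq0).atTop_mul_const hC)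
    have h1 : m.real {1} ≤ 0 := ge_of_tendsto hl (by
      filter_upwards [eventually_gt_atTop 0] with r hr using key r hr)
    have h2 : m.real {1} = 0 := le_antisymm h1 measureReal_nonneg
    rw [measureReal_eq_zero_iff] at h2
    simpa [ae_iff] using h2
  have hk : 0 < C ^ (-q) := rpow_pos_of_pos hC _
  refine ⟨m, hm, fun s => -(C ^ (-q) * log s), by fun_prop, ?_, fun r hr => ?_⟩
  · filter_upwards [h0, h1] with s hs0 hs1
    have a : 0 < (s:ℝ) := unitInterval.pos_iff_ne_zero.2 hs0
    have b : (s:ℝ) < 1 := unitInterval.lt_one_iff_ne_one.2 hs1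
    have := log_neg a b
    nlinarith
  · rcases hr.eq_or_lt with rfl | hr
    · simp [zero_rpow (inv_ne_zero (by positivity : q ≠ 0))]
    · have hh := h (r * C ^ (-q)) (by positivity)
      rw [mul_rpow hr.le hk.le, ← rpow_mul hC.le] at hh
      have e : -q * (1 / q) = -1 := by field_simp
      rw [e, mul_assoc, rpow_neg_one, inv_mul_cancel₀ hC.ne', mul_one] at hh
      rw [← hh]
      refine integral_congr_ae ?_
      filter_upwards [h0] with s hs0
      have a : 0 < (s:ℝ) := unitInterval.pos_iff_ne_zero.2 hs0
      rw [rpow_def_of_pos a]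
      ring_nf

theorem stmt_4 (p : ℝ) (hp1 : 1 ≤ p) (hp2 : p < 2) :
    ∃ ν : Measure ℝ, IsProbabilityMeasure ν ∧ ν (Set.Iic 0) = 0 ∧
      (¬ ∃ c : ℝ, ν = Measure.dirac c) ∧
      ∀ x : ℝ, exp (-|x| ^ p) / (2 * Gamma (1 + 1 / p))
        = ∫ v, (2 * π * v) ^ (-(1 : ℝ) / 2) * exp (-x ^ 2 / (2 * v)) ∂ν := by
  have hp0 : 0 < p := by linarith
  obtain ⟨m, hm, T, hT, hTpos, hL⟩ := exists_stable' (q := 2 / p) (by rw [lt_div_iff₀ hp0]; linarith)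
  have hG : 0 < 2 * Gamma (1 + 1 / p) := by
    have := Gamma_pos_of_pos (s := 1 + 1/p) (by positivity)
    positivity
  set G := 2 * Gamma (1 + 1 / p) with hGdef
  have hLx (x : ℝ) : ∫ s, exp (-(x ^ 2 * T s)) ∂m = exp (-|x| ^ p) := by
    rw [hL _ (sq_nonneg x), ← sq_abs, ← rpow_natCast, ← rpow_mul (abs_nonneg x)]
    congr 3
    push_cast
    field_simp
  have hint : ∫ x : ℝ, exp (-|x| ^ p) = G := by
    rw [integral_comp_abs (f := fun x => exp (-x ^ p)), integral_exp_neg_rpow hp0, hGdef, add_comm]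
  let D : unitInterval → ENNReal := fun s => ENNReal.ofReal (√(π / T s) / G)
  have hD : Measurable D := by fun_prop
  -- total mass
  have hmass : ∫⁻ s, ENNReal.ofReal √(π / T s) ∂m = ENNReal.ofReal G := by
    have e1 : ∫⁻ s, ENNReal.ofReal √(π / T s) ∂m
        = ∫⁻ s, (∫⁻ x : ℝ, ENNReal.ofReal (exp (-(x ^ 2 * T s)))) ∂m := by
      refine lintegral_congr_ae ?_
      filter_upwards [hTpos] with s hs
      rw [← integral_gaussian, ofReal_integral_eq_lintegral_ofReal (integrable_exp_neg_mul_sq hs)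
        (ae_of_all _ fun x => (exp_pos _).le)]
      refine lintegral_congr fun x => ?_
      ring_nf
    rw [e1, lintegral_lintegral_swap (by
      refine Measurable.aemeasurable ?_
      fun_prop), ← hint, ofReal_integral_eq_lintegral_ofReal]
    · refine lintegral_congr fun x => ?_
      rw [← hLx x, ofReal_integral_eq_lintegral_ofReal _ (ae_of_all _ fun x => (exp_pos _).le)]
      by_contra hne
      have := hLx x
      rw [integral_undef hne] at this
      exact (exp_pos _).ne this
    · by_contra hne
      rw [integral_undef hne] at hint
      exact hG.ne hint
    · exact ae_of_all _ fun x => (exp_pos _).le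
  have hprob : IsProbabilityMeasure (m.withDensity D) := by
    constructor
    rw [withDensity_apply _ MeasurableSet.univ, Measure.restrict_univ]
    simp only [D, div_eq_mul_inv _ G]
    simp_rw [ENNReal.ofReal_mul (sqrt_nonneg _)]
    rw [lintegral_mul_const _ (by fun_prop), hmass, ← ENNReal.ofReal_mul hG.le,
      mul_inv_cancel₀ hG.ne', ENNReal.ofReal_one]
  have hV : Measurable (fun s => 1 / (2 * T s)) := by fun_prop
  have hmain : ∀ x : ℝ, exp (-|x| ^ p) / G
        = ∫ v, (2 * π * v) ^ (-(1 : ℝ) / 2) * exp (-x ^ 2 / (2 * v))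
          ∂((m.withDensity D).map (fun s => 1 / (2 * T s))) := by
    intro x
    rw [integral_map hV.aemeasurable (by
      refine Measurable.aestronglyMeasurable ?_
      fun_prop), integral_withDensity_eq_integral_toReal_smul hD (by simp [D]), ← hLx,
      ← integral_div]
    refine integral_congr_ae ?_
    filter_upwards [hTpos] with s hs
    have e1 : 2 * π * (1 / (2 * T s)) = π / T s := by field_simp
    have e2 : -x ^ 2 / (2 * (1 / (2 * T s))) = -(x ^ 2 * T s) := by field_simp
    have hpos : 0 < √(π / T s) := sqrt_pos.2 (by positivity)
    simp only [D]
    rw [e1, e2, ENNReal.toReal_ofReal (by positivity), smul_eq_mul, neg_div,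
      rpow_neg (by positivity), ← sqrt_eq_rpow]
    field_simp
  refine ⟨(m.withDensity D).map (fun s => 1 / (2 * T s)),
    Measure.isProbabilityMeasure_map hV.aemeasurable, ?_, ?_, hmain⟩
  · rw [Measure.map_apply hV measurableSet_Iic]
    refine withDensity_absolutelyContinuous _ _ ?_
    refine measure_mono_null (fun s hs => ?_) (ae_iff.1 hTpos)
    simp only [mem_preimage, mem_Iic] at hs
    simp only [mem_ofPred_eq]
    intro hpos
    have : 0 < 1 / (2 * T s) := by positivity
    linarith
  · rintro ⟨c, hc⟩
    rw [hc] at hmain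
    simp only [integral_dirac] at hmain
    have h0 := hmain 0
    rw [abs_zero, zero_rpow hp0.ne'] at h0
    simp only [neg_zero, exp_zero, ne_eq, OfNat.ofNat_ne_zero, not_false_eq_true, zero_pow, zero_div,
      mul_one] at h0
    have hx (x : ℝ) : -|x| ^ p = -x ^ 2 / (2 * c) := by
      have := hmain x
      rw [← h0, div_mul_eq_mul_div, one_mul, div_left_inj' hG.ne'] at this
      exact exp_injective this
    have h1 := hx 1
    have h2 := hx 2
    have hlt : (2:ℝ) ^ p < 2 ^ (2:ℝ) := rpow_lt_rpow_of_exponent_lt (by norm_num) hp2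
    norm_num at h1 h2 hlt
    have : -(4:ℝ) / (2 * c) = 4 * (-1 / (2 * c)) := by ring
    rw [this, ← h1] at h2
    linarith
end
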